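/- PL(I) contains no subgroup isomorphic to the free group of rank 2. -/

import Mathlib

/-- The group of self-homeomorphisms of a space, with `(f * g) x = f (g x)`. -/
instance Homeomorph.instGroupSelf {M : Type*} [TopologicalSpace M] : Group (Homeomorph M M) where
  mul f g := g.trans f
  one := Homeomorph.refl M
  inv := Homeomorph.symm
  mul_assoc f g h := Homeomorph.ext fun _ => rfl
  one_mul f := Homeomorph.ext fun _ => rfl
  mul_one f := Homeomorph.ext fun _ => rfl
  inv_mul_cancel f := Homeomorph.ext fun x => f.symm_apply_apply x

/-- The unit interval `[0,1]`. -/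
abbrev UnitInt : Type := Set.Icc (0 : ℝ) 1

/-- `f` is an orientation-preserving piecewise linear homeomorphism of `[0,1]`:
it is strictly increasing and there is a finite partition `0 = t 0 < t 1 < ⋯ < t k = 1`
such that `f` is affine on each subinterval `[t i, t (i+1)]`. -/
def IsPLHomeo (f : Homeomorph UnitInt UnitInt) : Prop :=
  StrictMono f ∧
    ∃ (k : ℕ) (t : Fin (k + 1) → ℝ), t 0 = 0 ∧ t (Fin.last k) = 1 ∧ StrictMono t ∧
      ∀ i : Fin k, ∃ a b : ℝ, ∀ x : UnitInt,
        (x : ℝ) ∈ Set.Icc (t i.castSucc) (t i.succ) → (f x : ℝ) = a * (x : ℝ) + b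

open Filter Topology
open scoped commutatorElement

section FreeGroup

/-- A commutative free group is cyclic. -/
theorem IsFreeGroup.exists_zpowers_of_comm {H : Type*} [Group H] [IsFreeGroup H]
    (hcomm : ∀ x y : H, x * y = y * x) : ∃ z : H, ∀ x : H, x ∈ Subgroup.zpowers z := by
  have hsub : Subsingleton (IsFreeGroup.Generators H) := by
    refine ⟨fun i j => ?_⟩
    by_contra hij
    have h := hcomm (IsFreeGroup.of i) (IsFreeGroup.of j)
    classical
    let f : IsFreeGroup.Generators H → Equiv.Perm (Fin 3) :=
      fun k => if k = i then Equiv.swap 0 1 else Equiv.swap 1 2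
    have h' := congrArg (IsFreeGroup.lift f) h
    simp only [map_mul, IsFreeGroup.lift_of, f, if_true, if_neg (Ne.symm hij)] at h'
    exact absurd h' (by decide)
  let e := IsFreeGroup.toFreeGroup H
  obtain ⟨z, hz⟩ : ∃ z, Set.range (FreeGroup.of (α := IsFreeGroup.Generators H)) ⊆ {z} := by
    rcases isEmpty_or_nonempty (IsFreeGroup.Generators H) with hE | ⟨⟨i⟩⟩
    · exact ⟨1, by simp⟩
    · refine ⟨FreeGroup.of i, ?_⟩
      rintro _ ⟨j, rfl⟩
      rw [Subsingleton.elim j i]; rfl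
  refine ⟨e.symm z, fun x => ?_⟩
  have hx : e x ∈ Subgroup.zpowers z := by
    rw [Subgroup.zpowers_eq_closure]
    refine Subgroup.closure_mono hz ?_
    rw [FreeGroup.closure_range_of]
    trivial
  obtain ⟨n, hn⟩ := hx
  refine ⟨n, ?_⟩
  apply e.injective
  simpa using hn

/-- Commuting elements of a free group have a common power. -/
theorem IsFreeGroup.exists_zpow_eq_zpow_of_commute {G : Type*} [Group G] [IsFreeGroup G]
    {x y : G} (h : x * y = y * x) :
    ∃ m n : ℤ, (m ≠ 0 ∨ n ≠ 0) ∧ x ^ m = y ^ n := by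
  have hc : ∀ a ∈ ({x, y} : Set G), ∀ b ∈ ({x, y} : Set G), a * b = b * a := by
    rintro a (rfl | rfl) b (rfl | rfl) <;> first | rfl | exact h | exact h.symm
  have hK := Subgroup.isMulCommutative_closure hc
  obtain ⟨z, hz⟩ := IsFreeGroup.exists_zpowers_of_comm
    (H := Subgroup.closure ({x, y} : Set G)) (fun a b => mul_comm' a b)
  obtain ⟨p, hp⟩ := hz ⟨x, Subgroup.subset_closure (by simp)⟩
  obtain ⟨q, hq⟩ := hz ⟨y, Subgroup.subset_closure (by simp)⟩
  have hp' : (z : G) ^ p = x := congrArg Subtype.val hp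
  have hq' : (z : G) ^ q = y := congrArg Subtype.val hq
  by_cases h0 : p = 0 ∧ q = 0
  · refine ⟨1, 1, by simp, ?_⟩
    rw [h0.1, zpow_zero] at hp'
    rw [h0.2, zpow_zero] at hq'
    rw [zpow_one, zpow_one]
    exact hp'.symm.trans hq'
  · refine ⟨q, p, by tauto, ?_⟩
    calc x ^ q = ((z : G) ^ p) ^ q := by rw [hp']
      _ = ((z : G) ^ q) ^ p := by rw [← zpow_mul, ← zpow_mul, mul_comm]
      _ = y ^ p := by rw [hq']

end FreeGroup

section Germs

/-- Near a fixed point, a piecewise linear homeomorphism is linear to the right. -/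
theorem IsPLHomeo.exists_slope_right {f : Homeomorph UnitInt UnitInt} (hf : IsPLHomeo f)
    {p : UnitInt} (hp : f p = p) :
    ∃ a : ℝ, ∀ᶠ x : UnitInt in 𝓝 p, p ≤ x → (f x : ℝ) - p = a * (x - p) := by
  obtain ⟨-, k, t, h0, h1, ht, haff⟩ := hf
  rcases p.2.2.eq_or_lt with hp1 | hp1
  · refine ⟨0, Eventually.of_forall fun x hx => ?_⟩
    have : x = p := le_antisymm (Subtype.coe_le_coe.1 (x.2.2.trans_eq hp1.symm)) hx
    rw [this, hp]; ring
  · obtain ⟨i, hi, hmax⟩ := (Finset.univ.filter fun i => t i ≤ p).exists_max_image id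
      ⟨0, by simpa [h0] using p.2.1⟩
    simp only [Finset.mem_filter, Finset.mem_univ, true_and, id] at hi hmax
    have hne : i ≠ Fin.last k := by
      rintro rfl
      linarith
    obtain ⟨j, rfl⟩ := Fin.exists_castSucc_eq.2 hne
    have hj : (p : ℝ) < t j.succ := by
      by_contra! hle
      exact absurd (hmax _ hle) (not_le.2 (Fin.castSucc_lt_succ))
    obtain ⟨a, b, hab⟩ := haff j
    refine ⟨a, ?_⟩
    have hpp := hab p ⟨hi, hj.le⟩
    rw [hp] at hpp
    filter_upwards [continuous_subtype_val.continuousAt.eventually_lt_const hj] with x hx hpx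
    have := hab x ⟨hi.trans hpx, hx.le⟩
    linarith

/-- Near a fixed point, a piecewise linear homeomorphism is linear to the left. -/
theorem IsPLHomeo.exists_slope_left {f : Homeomorph UnitInt UnitInt} (hf : IsPLHomeo f)
    {p : UnitInt} (hp : f p = p) :
    ∃ a : ℝ, ∀ᶠ x : UnitInt in 𝓝 p, x ≤ p → (f x : ℝ) - p = a * (x - p) := by
  obtain ⟨-, k, t, h0, h1, ht, haff⟩ := hf
  rcases p.2.1.eq_or_lt with hp1 | hp1
  · refine ⟨0, Eventually.of_forall fun x hx => ?_⟩
    have : x = p := le_antisymm hx (Subtype.coe_le_coe.1 (hp1.symm.trans_le x.2.1))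
    rw [this, hp]; ring
  · obtain ⟨i, hi, hmin⟩ := (Finset.univ.filter fun i => (p : ℝ) ≤ t i).exists_min_image id
      ⟨Fin.last k, by simpa [h1] using p.2.2⟩
    simp only [Finset.mem_filter, Finset.mem_univ, true_and, id] at hi hmin
    have hne : i ≠ 0 := by
      rintro rfl
      linarith
    obtain ⟨j, rfl⟩ := Fin.exists_succ_eq.2 hne
    have hj : t j.castSucc < p := by
      by_contra! hle
      exact absurd (hmin _ hle) (not_le.2 (Fin.castSucc_lt_succ))
    obtain ⟨a, b, hab⟩ := haff j
    refine ⟨a, ?_⟩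
    have hpp := hab p ⟨hj.le, hi⟩
    rw [hp] at hpp
    filter_upwards [continuous_subtype_val.continuousAt.eventually_const_lt hj] with x hx hpx
    have := hab x ⟨hx.le, (Subtype.coe_le_coe.2 hpx).trans hi⟩
    linarith

/-- Piecewise linear homeomorphisms commute near a common fixed point. -/
theorem IsPLHomeo.eventually_comm {f g : Homeomorph UnitInt UnitInt} (hf : IsPLHomeo f)
    (hg : IsPLHomeo g) {p : UnitInt} (hfp : f p = p) (hgp : g p = p) :
    ∀ᶠ x in 𝓝 p, f (g x) = g (f x) := by
  obtain ⟨a, ha⟩ := hf.exists_slope_right hfp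
  obtain ⟨b, hb⟩ := hg.exists_slope_right hgp
  obtain ⟨c, hc⟩ := hf.exists_slope_left hfp
  obtain ⟨d, hd⟩ := hg.exists_slope_left hgp
  have hft : Tendsto f (𝓝 p) (𝓝 p) := by simpa [hfp] using f.continuous.tendsto p
  have hgt : Tendsto g (𝓝 p) (𝓝 p) := by simpa [hgp] using g.continuous.tendsto p
  filter_upwards [ha, hb, hc, hd, hgt.eventually ha, hft.eventually hb, hgt.eventually hc,
    hft.eventually hd] with x h1 h2 h3 h4 h5 h6 h7 h8
  have hfm := hf.1.monotone
  have hgm := hg.1.monotone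
  apply Subtype.ext
  rcases le_total p x with hx | hx
  · have e5 := h5 (hgp ▸ hgm hx)
    have e6 := h6 (hfp ▸ hfm hx)
    rw [h2 hx] at e5
    rw [h1 hx] at e6
    linarith
  · have e7 := h7 ((hgm hx).trans_eq hgp)
    have e8 := h8 ((hfm hx).trans_eq hfp)
    rw [h4 hx] at e7
    rw [h3 hx] at e8
    linarith

end Germs

section Action

variable {G : Type*} [Group G] (φ : G →* Homeomorph UnitInt UnitInt)

theorem homeoAction_mul (u v : G) (x : UnitInt) : φ (u * v) x = φ u (φ v x) := by
  rw [map_mul]; rfl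

theorem homeoAction_one (x : UnitInt) : φ 1 x = x := by
  rw [map_one]; rfl

theorem homeoAction_inv_apply (u : G) (x : UnitInt) : φ u⁻¹ (φ u x) = x := by
  rw [← homeoAction_mul, inv_mul_cancel, homeoAction_one]

theorem homeoAction_apply_inv (u : G) (x : UnitInt) : φ u (φ u⁻¹ x) = x := by
  rw [← homeoAction_mul, mul_inv_cancel, homeoAction_one]

/-- The subgroup of elements fixing a point. -/
def pointFixer (x : UnitInt) : Subgroup G where
  carrier := {u | φ u x = x}
  one_mem' := homeoAction_one φ x
  mul_mem' := fun {u v} (hu : φ u x = x) (hv : φ v x = x) => by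
    change φ (u * v) x = x
    rw [homeoAction_mul, hv, hu]
  inv_mem' := fun {u} (hu : φ u x = x) => by
    change φ u⁻¹ x = x
    conv_lhs => rw [← hu]
    exact homeoAction_inv_apply φ u x

theorem mem_pointFixer {x : UnitInt} {u : G} : u ∈ pointFixer φ x ↔ φ u x = x := Iff.rfl

theorem mem_pointFixer_conj {x : UnitInt} {u w : G} :
    u * w * u⁻¹ ∈ pointFixer φ x ↔ w ∈ pointFixer φ (φ u⁻¹ x) := by
  rw [mem_pointFixer, mem_pointFixer, homeoAction_mul, homeoAction_mul]
  constructor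
  · intro h
    conv_rhs => rw [← h]
    rw [homeoAction_inv_apply]
  · intro h
    rw [h, homeoAction_apply_inv]

/-- The elements acting as the identity near each global fixed point. -/
def germFixer : Subgroup G where
  carrier := {u | ∀ p, (∀ v, φ v p = p) → ∀ᶠ x in 𝓝 p, u ∈ pointFixer φ x}
  one_mem' := fun _ _ => Eventually.of_forall fun _ => one_mem _
  mul_mem' := fun hu hv p hp => by
    filter_upwards [hu p hp, hv p hp] with x h1 h2 using mul_mem h1 h2
  inv_mem' := fun hu p hp => by
    filter_upwards [hu p hp] with x h1 using inv_mem h1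

instance germFixer_normal : (germFixer φ).Normal := by
  refine ⟨fun w hw u p hp => ?_⟩
  have ht : Tendsto (φ u⁻¹) (𝓝 p) (𝓝 p) := by
    simpa only [hp] using (φ u⁻¹).continuous.tendsto p
  filter_upwards [ht.eventually (hw p hp)] with x hx
  exact (mem_pointFixer_conj φ).2 hx

/-- `(q.1, q.2)` is a maximal open interval without global fixed points. -/
structure IsFixGap (q : UnitInt × UnitInt) : Prop where
  left : ∀ u, φ u q.1 = q.1
  right : ∀ u, φ u q.2 = q.2
  lt : q.1 < q.2
  gap : ∀ x ∈ Set.Ioo q.1 q.2, ∃ u, φ u x ≠ x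

variable {φ}

theorem mem_pointFixer_of_pow (hφ : ∀ u, StrictMono (φ u)) {x : UnitInt} {w : G} {n : ℕ}
    (hn : n ≠ 0) (h : w ^ n ∈ pointFixer φ x) : w ∈ pointFixer φ x := by
  obtain ⟨k, rfl⟩ := Nat.exists_eq_succ_of_ne_zero hn
  rw [mem_pointFixer] at h
  rcases lt_trichotomy (φ w x) x with hlt | heq | hgt
  · have key : ∀ k : ℕ, φ (w ^ (k + 1)) x < x := by
      intro k
      induction k with
      | zero => simpa using hlt
      | succ k ih =>
        rw [pow_succ', homeoAction_mul]
        exact (hφ w ih).trans hlt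
    exact absurd h (key k).ne
  · exact heq
  · have key : ∀ k : ℕ, x < φ (w ^ (k + 1)) x := by
      intro k
      induction k with
      | zero => simpa using hgt
      | succ k ih =>
        rw [pow_succ', homeoAction_mul]
        exact hgt.trans (hφ w ih)
    exact absurd h (key k).ne'

theorem mem_pointFixer_of_zpow (hφ : ∀ u, StrictMono (φ u)) {x : UnitInt} {w : G} {m : ℤ}
    (hm : m ≠ 0) (h : w ^ m ∈ pointFixer φ x) : w ∈ pointFixer φ x := by
  refine mem_pointFixer_of_pow hφ (Int.natAbs_ne_zero.2 hm) ?_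
  rcases Int.natAbs_eq m with h' | h'
  · rw [h', zpow_natCast] at h
    exact h
  · rw [h', zpow_neg, zpow_natCast] at h
    exact inv_mem_iff.1 h

theorem IsFixGap.apply_mem (hφ : ∀ u, StrictMono (φ u)) {q : UnitInt × UnitInt}
    (hq : IsFixGap φ q) (u : G) {x : UnitInt} (hx : x ∈ Set.Ioo q.1 q.2) :
    φ u x ∈ Set.Ioo q.1 q.2 :=
  ⟨(hq.left u).symm.trans_lt (hφ u hx.1), (hφ u hx.2).trans_eq (hq.right u)⟩

theorem homeoAction_zero (hφ : ∀ u, StrictMono (φ u)) (u : G) : φ u 0 = 0 := by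
  refine le_antisymm ?_ (φ u 0).2.1
  have h := (hφ u).monotone (show (0 : UnitInt) ≤ φ u⁻¹ 0 from (φ u⁻¹ 0).2.1)
  rwa [homeoAction_apply_inv] at h

theorem homeoAction_unit (hφ : ∀ u, StrictMono (φ u)) (u : G) : φ u 1 = 1 := by
  refine le_antisymm (φ u 1).2.2 ?_
  have h := (hφ u).monotone (show φ u⁻¹ 1 ≤ (1 : UnitInt) from (φ u⁻¹ 1).2.2)
  rwa [homeoAction_apply_inv] at h

theorem exists_isFixGap (hφ : ∀ u, StrictMono (φ u)) {x : UnitInt} (hx : ∃ u, φ u x ≠ x) :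
    ∃ q, IsFixGap φ q ∧ x ∈ Set.Ioo q.1 q.2 := by
  have hF : IsClosed {p : UnitInt | ∀ u, φ u p = p} := by
    simp only [Set.ofPred_forall]
    exact isClosed_iInter fun u => isClosed_eq (φ u).continuous continuous_id
  have hxF : ¬ ∀ u, φ u x = x := by simpa using hx
  obtain ⟨a, ⟨haF, hax⟩, hamax⟩ := (hF.inter (isClosed_Iic (a := x))).isCompact.exists_isGreatest
    ⟨0, homeoAction_zero hφ, x.2.1⟩
  obtain ⟨b, ⟨hbF, hxb⟩, hbmin⟩ := (hF.inter (isClosed_Ici (a := x))).isCompact.exists_isLeast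
    ⟨1, homeoAction_unit hφ, x.2.2⟩
  have hax' : a < x := lt_of_le_of_ne hax (by rintro rfl; exact hxF haF)
  have hxb' : x < b := lt_of_le_of_ne hxb (by rintro rfl; exact hxF hbF)
  refine ⟨(a, b), ⟨haF, hbF, hax'.trans hxb', fun y hy => ?_⟩, hax', hxb'⟩
  by_contra! hyF
  rcases le_total y x with h | h
  · exact absurd (hamax ⟨hyF, h⟩) (not_le.2 hy.1)
  · exact absurd (hbmin ⟨hyF, h⟩) (not_le.2 hy.2)

/-- Inside a gap, points can be moved arbitrarily close to the right end. -/
theorem IsFixGap.exists_lt_apply (hφ : ∀ u, StrictMono (φ u)) {q : UnitInt × UnitInt}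
    (hq : IsFixGap φ q) {c d : UnitInt} (hc : q.1 < c) (hd : d < q.2) : ∃ u, d < φ u c := by
  by_contra! h
  obtain ⟨e, he⟩ : ∃ e, IsLUB (Set.range fun u => φ u c) e := ⟨_, isLUB_sSup _⟩
  have hce : c ≤ e := he.1 ⟨1, homeoAction_one φ c⟩
  have hed : e ≤ d := he.2 (by rintro _ ⟨u, rfl⟩; exact h u)
  have hle : ∀ u, e ≤ φ u e := by
    refine fun u => he.2 ?_
    rintro _ ⟨v, rfl⟩
    have h1 := (hφ u).monotone (he.1 ⟨u⁻¹ * v, rfl⟩)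
    simpa only [homeoAction_mul, homeoAction_apply_inv] using h1
  obtain ⟨u, hu⟩ := hq.gap e ⟨hc.trans_le hce, hed.trans_lt hd⟩
  refine hu (le_antisymm ?_ (hle u))
  have h1 := (hφ u).monotone (hle u⁻¹)
  rwa [homeoAction_apply_inv] at h1

theorem IsFixGap.exists_left {q : UnitInt × UnitInt} (hq : IsFixGap φ q) {w : G} (hw : w ∈ germFixer φ) :
    ∃ c, q.1 < c ∧ ∀ x, q.1 < x → x ≤ c → w ∈ pointFixer φ x := by
  obtain ⟨r, hr, hsub⟩ := (mem_nhdsGT_iff_exists_mem_Ioc_Ioo_subset hq.lt).1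
    (mem_nhdsWithin_of_mem_nhds (hw q.1 hq.left))
  obtain ⟨c, hc, hcr⟩ := exists_between hr.1
  exact ⟨c, hc, fun x h1 h2 => hsub ⟨h1, h2.trans_lt hcr⟩⟩

theorem IsFixGap.exists_right {q : UnitInt × UnitInt} (hq : IsFixGap φ q) {w : G} (hw : w ∈ germFixer φ) :
    ∃ d, d < q.2 ∧ ∀ x, d ≤ x → x < q.2 → w ∈ pointFixer φ x := by
  obtain ⟨r, hr, hsub⟩ := (mem_nhdsLT_iff_exists_mem_Ico_Ioo_subset hq.lt).1
    (mem_nhdsWithin_of_mem_nhds (hw q.2 hq.right))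
  obtain ⟨d, hrd, hd⟩ := exists_between hr.2
  exact ⟨d, hd, fun x h1 h2 => hsub ⟨hrd.trans_le h1, h2⟩⟩

/-- Some conjugate of an element of `germFixer φ` has disjoint support from it in a given gap. -/
theorem IsFixGap.exists_conj_disjoint (hφ : ∀ u, StrictMono (φ u)) {q : UnitInt × UnitInt}
    (hq : IsFixGap φ q) {w : G} (hw : w ∈ germFixer φ) :
    ∃ u, ∀ x ∈ Set.Ioo q.1 q.2, w ∈ pointFixer φ x ∨ u * w * u⁻¹ ∈ pointFixer φ x := by
  obtain ⟨c, hc, hcw⟩ := hq.exists_left hw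
  obtain ⟨d, hd, hdw⟩ := hq.exists_right hw
  obtain ⟨u, hu⟩ := hq.exists_lt_apply hφ hc hd
  refine ⟨u, fun x hx => ?_⟩
  rcases le_or_gt d x with h | h
  · exact Or.inl (hdw x h hx.2)
  · have h1 := hφ u⁻¹ (h.trans hu)
    rw [homeoAction_inv_apply] at h1
    exact Or.inr ((mem_pointFixer_conj φ).2 (hcw _ (hq.apply_mem hφ u⁻¹ hx).1 h1.le))

theorem apply_comm_of_disjoint {v w : G} {y : UnitInt}
    (hy : v ∈ pointFixer φ y)
    (h : v ∈ pointFixer φ (φ w y) ∨ w ∈ pointFixer φ (φ w y)) :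
    φ v (φ w y) = φ w (φ v y) := by
  rw [mem_pointFixer] at hy
  rw [hy]
  rcases h with h | h
  · exact h
  · have : φ w y = y := (φ w).injective h
    rw [this, hy]

theorem commutatorElement_mem_pointFixer (v w : G) {x : UnitInt}
    (h : φ v (φ w (φ (w * v)⁻¹ x)) = φ w (φ v (φ (w * v)⁻¹ x))) : ⁅v, w⁆ ∈ pointFixer φ x := by
  have e : ⁅v, w⁆ = v * w * (w * v)⁻¹ := by rw [commutatorElement_def]; group
  rw [mem_pointFixer, e, homeoAction_mul, homeoAction_mul, h, ← homeoAction_mul,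
    homeoAction_apply_inv]

/-- An element of `germFixer φ` supported in finitely many gaps is trivial, if the action is
faithful and commuting elements have common powers. -/
theorem eq_one_of_support_subset_gaps (hφ : ∀ u, StrictMono (φ u)) (hinj : Function.Injective φ)
    (hpow : ∀ x y : G, x * y = y * x → ∃ m n : ℤ, (m ≠ 0 ∨ n ≠ 0) ∧ x ^ m = y ^ n)
    (T : Finset (UnitInt × UnitInt)) (hT : ∀ q ∈ T, IsFixGap φ q) {w : G}
    (hw : w ∈ germFixer φ)
    (hsupp : ∀ x, w ∉ pointFixer φ x → ∃ q ∈ T, x ∈ Set.Ioo q.1 q.2) : w = 1 := by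
  classical
  induction T using Finset.induction_on generalizing w with
  | empty =>
    apply hinj
    ext1 x
    rw [homeoAction_one]
    by_contra hx
    obtain ⟨q, hq, -⟩ := hsupp x hx
    simp at hq
  | insert q T _ ih =>
    have hq := hT q (Finset.mem_insert_self q T)
    have drop : ∀ v ∈ germFixer φ,
        (∀ x, v ∉ pointFixer φ x → ∃ r ∈ insert q T, x ∈ Set.Ioo r.1 r.2) →
        (∀ x ∈ Set.Ioo q.1 q.2, v ∈ pointFixer φ x) → v = 1 := by
      intro v hv hvs hvq
      refine ih (fun r hr => hT r (Finset.mem_insert_of_mem hr)) hv fun x hx => ?_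
      obtain ⟨r, hr, hxr⟩ := hvs x hx
      rcases Finset.mem_insert.1 hr with rfl | hr
      · exact absurd (hvq x hxr) hx
      · exact ⟨r, hr, hxr⟩
    obtain ⟨u, hu⟩ := hq.exists_conj_disjoint hφ hw
    set w' := u * w * u⁻¹ with hw'
    have hwg' : w' ∈ germFixer φ := (germFixer_normal φ).conj_mem w hw u
    have hsupp' : ∀ x, w' ∉ pointFixer φ x → ∃ r ∈ insert q T, x ∈ Set.Ioo r.1 r.2 := by
      intro x hx
      obtain ⟨r, hr, hxr⟩ := hsupp _ (fun h => hx ((mem_pointFixer_conj φ).2 h))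
      refine ⟨r, hr, ?_⟩
      have := (hT r hr).apply_mem hφ u hxr
      rwa [homeoAction_apply_inv] at this
    have hcomm : ⁅w, w'⁆ = 1 := by
      refine drop _ ?_ ?_ ?_
      · rw [commutatorElement_def]
        exact mul_mem (mul_mem (mul_mem hw hwg') (inv_mem hw)) (inv_mem hwg')
      · intro x hx
        by_contra hno
        have h1 : w ∈ pointFixer φ x := by_contra fun h => hno (hsupp x h)
        have h2 : w' ∈ pointFixer φ x := by_contra fun h => hno (hsupp' x h)
        refine hx ?_
        rw [commutatorElement_def]
        exact mul_mem (mul_mem (mul_mem h1 h2) (inv_mem h1)) (inv_mem h2)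
      · intro x hx
        apply commutatorElement_mem_pointFixer
        have hy := hq.apply_mem hφ (w' * w)⁻¹ hx
        rcases hu _ hy with h | h
        · exact apply_comm_of_disjoint h (hu _ (hq.apply_mem hφ w' hy))
        · exact (apply_comm_of_disjoint h (hu _ (hq.apply_mem hφ w hy)).symm).symm
    obtain ⟨m, n, hmn, hpw⟩ := hpow w w' (commutatorElement_eq_one_iff_mul_comm.1 hcomm)
    rcases hmn with hm | hn
    · refine drop w hw hsupp fun x hx => ?_
      refine (hu x hx).elim id fun h => mem_pointFixer_of_zpow hφ hm ?_
      rw [hpw]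
      exact zpow_mem h n
    · refine conj_eq_one_iff.1 (drop w' hwg' hsupp' fun x hx => ?_)
      refine (hu x hx).elim (fun h => mem_pointFixer_of_zpow hφ hn ?_) id
      rw [← hpw]
      exact zpow_mem h m

/-- The support of an element of `germFixer φ` is covered by finitely many gaps. -/
theorem exists_finset_gaps (hφ : ∀ u, StrictMono (φ u)) {w : G} (hw : w ∈ germFixer φ) :
    ∃ T : Finset (UnitInt × UnitInt), (∀ q ∈ T, IsFixGap φ q) ∧
      ∀ x, w ∉ pointFixer φ x → ∃ q ∈ T, x ∈ Set.Ioo q.1 q.2 := by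
  classical
  suffices h : ∃ T : Finset (UnitInt × UnitInt), (∀ q ∈ T, IsFixGap φ q) ∧
      ∀ x ∈ (Set.univ : Set UnitInt), w ∉ pointFixer φ x → ∃ q ∈ T, x ∈ Set.Ioo q.1 q.2 by
    simpa using h
  refine isCompact_univ.induction_on
    (p := fun s => ∃ T : Finset (UnitInt × UnitInt), (∀ q ∈ T, IsFixGap φ q) ∧
      ∀ x ∈ s, w ∉ pointFixer φ x → ∃ q ∈ T, x ∈ Set.Ioo q.1 q.2) ?_ ?_ ?_ ?_
  · exact ⟨∅, by simp, by simp⟩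
  · rintro s t hst ⟨T, hT, h⟩
    exact ⟨T, hT, fun x hx => h x (hst hx)⟩
  · rintro s t ⟨S, hS, hs⟩ ⟨T, hT, ht⟩
    refine ⟨S ∪ T, fun q hq => (Finset.mem_union.1 hq).elim (hS q) (hT q), ?_⟩
    rintro x (hx | hx) hxw
    · obtain ⟨q, hq, h⟩ := hs x hx hxw
      exact ⟨q, Finset.mem_union_left _ hq, h⟩
    · obtain ⟨q, hq, h⟩ := ht x hx hxw
      exact ⟨q, Finset.mem_union_right _ hq, h⟩
  · intro x _
    rw [nhdsWithin_univ]
    by_cases hx : ∀ u, φ u x = x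
    · exact ⟨_, hw x hx, ∅, by simp, fun y hy hyw => absurd hy hyw⟩
    · push Not at hx
      obtain ⟨q, hq, hxq⟩ := exists_isFixGap hφ hx
      exact ⟨_, Ioo_mem_nhds hxq.1 hxq.2, {q}, by simpa using hq,
        fun y hy _ => ⟨q, Finset.mem_singleton_self q, hy⟩⟩

theorem commutatorElement_mem_germFixer {v w : G} (hv : IsPLHomeo (φ v)) (hw : IsPLHomeo (φ w)) :
    ⁅v, w⁆ ∈ germFixer φ := by
  intro p hp
  have ht : Tendsto (φ (w * v)⁻¹) (𝓝 p) (𝓝 p) := by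
    simpa only [hp] using (φ (w * v)⁻¹).continuous.tendsto p
  filter_upwards [ht.eventually (hv.eventually_comm hw (hp v) (hp w))] with x hx
  exact commutatorElement_mem_pointFixer v w hx

end Action

/-- **Brin–Squier.** `PL(I)` contains no subgroup isomorphic to the free group of rank 2:
there is no injective homomorphism from the free group on two generators into the group of
homeomorphisms of `[0,1]` whose image consists of piecewise linear homeomorphisms. -/
theorem plI_no_free_subgroup :
    ¬ ∃ φ : FreeGroup (Fin 2) →* Homeomorph UnitInt UnitInt,
        Function.Injective φ ∧ ∀ w, IsPLHomeo (φ w) := by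
  rintro ⟨φ, hinj, hPL⟩
  have hφ : ∀ u, StrictMono (φ u) := fun u => (hPL u).1
  have hw : ⁅FreeGroup.of (0 : Fin 2), FreeGroup.of 1⁆ ∈ germFixer φ :=
    commutatorElement_mem_germFixer (hPL _) (hPL _)
  obtain ⟨T, hT, hsupp⟩ := exists_finset_gaps hφ hw
  have h := eq_one_of_support_subset_gaps hφ hinj
    (fun _ _ => IsFreeGroup.exists_zpow_eq_zpow_of_commute) T hT hw hsupp
  rw [commutatorElement_eq_one_iff_mul_comm] at h
  exact absurd h (by decide)
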